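/- The total volume of active sites in the rule 150 space-time pattern scales with the largest eigenvalue 1 + √5 of the block-sum iteration matrix: the sequence n ↦ (S(n) : ℝ)^(1/n) tends to 1 + √5 as n → ∞. -/

import Mathlib

/-- Rule 150 elementary cellular automaton, started from a single seed at the origin. -/
def rule150 : ℕ → ℤ → ZMod 2
  | 0, n => if n = 0 then 1 else 0
  | t + 1, n => rule150 t (n - 1) + rule150 t n + rule150 t (n + 1)

/-- Total activity: the number of active sites at time `t`. -/
noncomputable def totalActivity (t : ℕ) : ℕ := {n : ℤ | rule150 t n = 1}.ncard

/-- Block sum of the total activity over the first `2 ^ n` time steps. -/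
noncomputable def blockSum (n : ℕ) : ℕ := ∑ i ∈ Finset.range (2 ^ n), totalActivity i

theorem rule150_eq_zero_of_lt_abs (t : ℕ) : ∀ n : ℤ, (t : ℤ) < |n| → rule150 t n = 0 := by
  induction t with
  | zero => intro n hn; simp [rule150]; simpa using hn
  | succ t ih =>
    intro n hn
    rw [lt_abs] at hn
    have aux : ∀ m : ℤ, ((t : ℤ) < m ∨ (t : ℤ) < -m) → rule150 t m = 0 :=
      fun m hm => ih m (lt_abs.2 hm)
    push_cast at hn
    simp only [rule150]
    rw [aux (n - 1) (by omega), aux n (by omega), aux (n + 1) (by omega)]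
    simp

theorem finite_setOf_rule150_eq_one (t : ℕ) : {n : ℤ | rule150 t n = 1}.Finite := by
  refine (Set.finite_Icc (-(t : ℤ)) t).subset fun n hn => ?_
  rw [Set.mem_Icc, ← abs_le]
  by_contra! h
  have hn' : rule150 t n = 1 := hn
  simp [rule150_eq_zero_of_lt_abs t n h] at hn'

theorem rule150_add_two (t : ℕ) (n : ℤ) :
    rule150 (t + 2) n = rule150 t (n - 2) + rule150 t n + rule150 t (n + 2) := by
  have h : ∀ a b c d e : ZMod 2, a + b + c + (b + c + d) + (c + d + e) = a + c + e := by decide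
  simp only [rule150, sub_add_cancel, add_sub_cancel_right]
  rw [show n - 1 - 1 = n - 2 by ring, show n + 1 + 1 = n + 2 by ring]
  exact h _ _ _ _ _

theorem rule150_two_mul (t : ℕ) :
    ∀ k : ℤ, rule150 (2 * t) (2 * k) = rule150 t k ∧ rule150 (2 * t) (2 * k + 1) = 0 := by
  induction t with
  | zero =>
    intro k
    simp only [rule150]
    exact ⟨by simp, if_neg (by omega)⟩
  | succ t ih =>
    intro k
    rw [Nat.mul_succ, rule150_add_two, rule150_add_two]
    rw [show 2 * k - 2 = 2 * (k - 1) by ring, show 2 * k + 2 = 2 * (k + 1) by ring,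
      show 2 * k + 1 - 2 = 2 * (k - 1) + 1 by ring, show 2 * k + 1 + 2 = 2 * (k + 1) + 1 by ring]
    simp [ih, rule150]

theorem rule150_two_mul_add_one_even (t : ℕ) (k : ℤ) :
    rule150 (2 * t + 1) (2 * k) = rule150 t k := by
  rw [rule150, show 2 * k - 1 = 2 * (k - 1) + 1 by ring]
  simp [rule150_two_mul]

theorem rule150_two_mul_add_one_odd (t : ℕ) (k : ℤ) :
    rule150 (2 * t + 1) (2 * k + 1) = rule150 t k + rule150 t (k + 1) := by
  rw [rule150, show 2 * k + 1 - 1 = 2 * k by ring, show 2 * k + 1 + 1 = 2 * (k + 1) by ring]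
  simp [rule150_two_mul]

theorem ncard_setOf_eq_even_add_odd {P : ℤ → Prop} (he : {k : ℤ | P (2 * k)}.Finite)
    (ho : {k : ℤ | P (2 * k + 1)}.Finite) :
    {n : ℤ | P n}.ncard = {k : ℤ | P (2 * k)}.ncard + {k : ℤ | P (2 * k + 1)}.ncard := by
  have hu : {n : ℤ | P n} = (fun k : ℤ => 2 * k) '' {k : ℤ | P (2 * k)} ∪
      (fun k : ℤ => 2 * k + 1) '' {k : ℤ | P (2 * k + 1)} := by
    ext n
    simp only [Set.mem_union, Set.mem_image, Set.mem_ofPred_eq]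
    constructor
    · intro h
      obtain ⟨k, rfl | rfl⟩ := n.even_or_odd'
      · exact Or.inl ⟨k, h, rfl⟩
      · exact Or.inr ⟨k, h, rfl⟩
    · rintro (⟨k, h, rfl⟩ | ⟨k, h, rfl⟩) <;> exact h
  rw [hu, Set.ncard_union_eq _ (he.image _) (ho.image _),
    Set.ncard_image_of_injective _ (fun a b h => by simpa using h),
    Set.ncard_image_of_injective _ (fun a b h => by simpa using h)]
  rw [Set.disjoint_left]
  rintro _ ⟨a, -, rfl⟩ ⟨b, -, h⟩
  simp only at h
  omega

/-- The number of sites `n` at which sites `n` and `n + 1` differ at time `t`. -/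
noncomputable def boundaryActivity (t : ℕ) : ℕ :=
  {n : ℤ | rule150 t n + rule150 t (n + 1) = 1}.ncard

theorem finite_setOf_rule150_succ_eq_one (t : ℕ) : {n : ℤ | rule150 t (n + 1) = 1}.Finite :=
  (finite_setOf_rule150_eq_one t).preimage (add_left_injective 1).injOn

theorem ncard_setOf_rule150_succ_eq_one (t : ℕ) :
    {n : ℤ | rule150 t (n + 1) = 1}.ncard = totalActivity t :=
  Set.ncard_preimage_of_injective_subset_range (s := {n : ℤ | rule150 t n = 1})
    (add_left_injective (1 : ℤ))
    fun n _ => ⟨n - 1, by simp⟩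

theorem finite_setOf_rule150_add_succ_eq_one (t : ℕ) :
    {n : ℤ | rule150 t n + rule150 t (n + 1) = 1}.Finite := by
  refine ((finite_setOf_rule150_eq_one t).union (finite_setOf_rule150_succ_eq_one t)).subset ?_
  have h : ∀ a b : ZMod 2, a + b = 1 → a = 1 ∨ b = 1 := by decide
  exact fun n hn => h _ _ hn

theorem totalActivity_two_mul (t : ℕ) : totalActivity (2 * t) = totalActivity t := by
  rw [totalActivity, ncard_setOf_eq_even_add_odd]
  · simp [rule150_two_mul, totalActivity]
  · simpa [rule150_two_mul] using finite_setOf_rule150_eq_one t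
  · simp [rule150_two_mul]

theorem totalActivity_two_mul_add_one (t : ℕ) :
    totalActivity (2 * t + 1) = totalActivity t + boundaryActivity t := by
  rw [totalActivity, ncard_setOf_eq_even_add_odd]
  · simp only [rule150_two_mul_add_one_even, rule150_two_mul_add_one_odd]
    rfl
  · simpa only [rule150_two_mul_add_one_even] using finite_setOf_rule150_eq_one t
  · simpa only [rule150_two_mul_add_one_odd] using finite_setOf_rule150_add_succ_eq_one t

theorem boundaryActivity_two_mul (t : ℕ) : boundaryActivity (2 * t) = 2 * totalActivity t := by
  have he : ∀ k : ℤ, rule150 (2 * t) (2 * k) + rule150 (2 * t) (2 * k + 1) = rule150 t k := by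
    simp [rule150_two_mul]
  have ho : ∀ k : ℤ, rule150 (2 * t) (2 * k + 1) + rule150 (2 * t) (2 * k + 1 + 1) =
      rule150 t (k + 1) := by
    intro k
    rw [show 2 * k + 1 + 1 = 2 * (k + 1) by ring]
    simp [rule150_two_mul]
  rw [boundaryActivity, ncard_setOf_eq_even_add_odd]
  · simp only [he, ho, ncard_setOf_rule150_succ_eq_one]
    rw [← totalActivity, two_mul]
  · simpa only [he] using finite_setOf_rule150_eq_one t
  · simpa only [ho] using finite_setOf_rule150_succ_eq_one t

theorem boundaryActivity_two_mul_add_one (t : ℕ) :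
    boundaryActivity (2 * t + 1) = 2 * totalActivity t := by
  have he : ∀ k : ℤ, rule150 (2 * t + 1) (2 * k) + rule150 (2 * t + 1) (2 * k + 1) =
      rule150 t (k + 1) := by
    intro k
    rw [rule150_two_mul_add_one_even, rule150_two_mul_add_one_odd, ← add_assoc,
      CharTwo.add_self_eq_zero, zero_add]
  have ho : ∀ k : ℤ, rule150 (2 * t + 1) (2 * k + 1) + rule150 (2 * t + 1) (2 * k + 1 + 1) =
      rule150 t k := by
    intro k
    rw [show 2 * k + 1 + 1 = 2 * (k + 1) by ring, rule150_two_mul_add_one_even,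
      rule150_two_mul_add_one_odd, add_assoc, CharTwo.add_self_eq_zero, add_zero]
  rw [boundaryActivity, ncard_setOf_eq_even_add_odd]
  · simp only [he, ho, ncard_setOf_rule150_succ_eq_one]
    rw [← totalActivity, two_mul]
  · simpa only [he] using finite_setOf_rule150_succ_eq_one t
  · simpa only [ho] using finite_setOf_rule150_eq_one t

theorem sum_range_two_mul (f : ℕ → ℕ) (m : ℕ) :
    ∑ i ∈ Finset.range (2 * m), f i = ∑ i ∈ Finset.range m, (f (2 * i) + f (2 * i + 1)) := by
  induction m with
  | zero => simp
  | succ m ih => rw [Nat.mul_succ, Finset.sum_range_succ, Finset.sum_range_succ, ih,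
      Finset.sum_range_succ, add_assoc]

theorem blockSum_succ (n : ℕ) :
    blockSum (n + 1) = 2 * blockSum n + ∑ i ∈ Finset.range (2 ^ n), boundaryActivity i := by
  rw [blockSum, pow_succ', sum_range_two_mul, blockSum, Finset.mul_sum, ← Finset.sum_add_distrib]
  refine Finset.sum_congr rfl fun i _ => ?_
  rw [totalActivity_two_mul, totalActivity_two_mul_add_one]
  ring

theorem blockSum_add_two (n : ℕ) : blockSum (n + 2) = 2 * blockSum (n + 1) + 4 * blockSum n := by
  rw [blockSum_succ (n + 1), pow_succ', sum_range_two_mul, blockSum, blockSum, Finset.mul_sum _ _ 4]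
  congr 1
  refine Finset.sum_congr rfl fun i _ => ?_
  rw [boundaryActivity_two_mul, boundaryActivity_two_mul_add_one]
  ring

theorem totalActivity_zero : totalActivity 0 = 1 := by
  simp [totalActivity, rule150]

theorem boundaryActivity_zero : boundaryActivity 0 = 2 := by
  rw [← Nat.mul_zero 2, boundaryActivity_two_mul, totalActivity_zero]

theorem blockSum_zero : blockSum 0 = 1 := by
  simp [blockSum, totalActivity_zero]

theorem blockSum_one : blockSum 1 = 4 := by
  rw [blockSum_succ, blockSum_zero]
  simp [boundaryActivity_zero]

theorem blockSum_bounds (n : ℕ) :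
    (1 + Real.sqrt 5) ^ n ≤ blockSum n ∧ (blockSum n : ℝ) ≤ 2 * (1 + Real.sqrt 5) ^ n := by
  have h5 : Real.sqrt 5 ^ 2 = 5 := Real.sq_sqrt (by norm_num)
  have h0 : 0 ≤ Real.sqrt 5 := Real.sqrt_nonneg 5
  induction n using Nat.twoStepInduction with
  | zero => norm_num [blockSum_zero]
  | one =>
    rw [blockSum_one]
    push_cast
    constructor <;> nlinarith
  | more n ih₀ ih₁ =>
    have hp : (1 + Real.sqrt 5) ^ (n + 2) =
        2 * (1 + Real.sqrt 5) ^ (n + 1) + 4 * (1 + Real.sqrt 5) ^ n := by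
      linear_combination (1 + Real.sqrt 5) ^ n * h5
    rw [blockSum_add_two, hp]
    push_cast
    constructor <;> linarith [ih₀.1, ih₀.2, ih₁.1, ih₁.2]

theorem blockSum_growth_rate :
    Filter.Tendsto (fun n : ℕ => (blockSum n : ℝ) ^ ((n : ℝ)⁻¹))
      Filter.atTop (nhds (1 + Real.sqrt 5)) := by
  have hpos : (0 : ℝ) ≤ 1 + Real.sqrt 5 := by positivity
  have hlim : Filter.Tendsto (fun n : ℕ => (2 : ℝ) ^ ((n : ℝ)⁻¹) * (1 + Real.sqrt 5))
      Filter.atTop (nhds (1 + Real.sqrt 5)) := by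
    have h := Filter.Tendsto.rpow (tendsto_const_nhds (x := (2 : ℝ)))
      (tendsto_inv_atTop_nhds_zero_nat (𝕜 := ℝ)) (Or.inl two_ne_zero)
    simpa using h.mul_const (1 + Real.sqrt 5)
  refine tendsto_of_tendsto_of_tendsto_of_le_of_le' tendsto_const_nhds hlim ?_ ?_
  · filter_upwards [Filter.eventually_ne_atTop 0] with n hn
    calc 1 + Real.sqrt 5 = ((1 + Real.sqrt 5) ^ n) ^ ((n : ℝ)⁻¹) :=
          (Real.pow_rpow_inv_natCast hpos hn).symm
      _ ≤ _ := Real.rpow_le_rpow (by positivity) (blockSum_bounds n).1 (by positivity)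
  · filter_upwards [Filter.eventually_ne_atTop 0] with n hn
    calc (blockSum n : ℝ) ^ ((n : ℝ)⁻¹) ≤ (2 * (1 + Real.sqrt 5) ^ n) ^ ((n : ℝ)⁻¹) :=
          Real.rpow_le_rpow (by positivity) (blockSum_bounds n).2 (by positivity)
      _ = _ := by
          rw [Real.mul_rpow (by norm_num) (by positivity), Real.pow_rpow_inv_natCast hpos hn]
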